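/- Single hidden layer geometric initialization (expectation form): Let f(x) = (√(2π)/(σk))·Σ_{i=1}^k max(w_i·x, 0) - r where w_1,…,w_k ∈ ℝ^d are i.i.d. random vectors with i.i.d. N(0,σ²) entries. Then for every fixed x ∈ ℝ^d, E[f(x)] = ‖x‖ - r. -/

import Mathlib

open Real MeasureTheory ProbabilityTheory

lemma aux_law {d : ℕ} (v : NNReal) (x : EuclideanSpace ℝ (Fin d)) :
    (Measure.pi fun _ : Fin d => gaussianReal 0 v).map (fun w => ∑ j, w j * x j)
      = gaussianReal 0 (v * ‖x‖₊ ^ 2) := by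
  have hm : Measurable (fun w : Fin d → ℝ => ∑ j, w j * x j) := by fun_prop
  have : IsProbabilityMeasure ((Measure.pi fun _ : Fin d => gaussianReal 0 v).map
      (fun w => ∑ j, w j * x j)) := Measure.isProbabilityMeasure_map hm.aemeasurable
  apply Measure.ext_of_charFun
  ext t
  rw [charFun_gaussianReal, charFun_apply_real,
    integral_map hm.aemeasurable (by fun_prop)]
  have h1 : ∀ w : Fin d → ℝ, Complex.exp (t * ((∑ j, w j * x j : ℝ) : ℂ) * Complex.I)
      = ∏ j, Complex.exp (((t * x j : ℝ) : ℂ) * (w j : ℂ) * Complex.I) := by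
    intro w
    rw [← Complex.exp_sum]
    congr 1
    push_cast
    rw [Finset.mul_sum, Finset.sum_mul]
    refine Finset.sum_congr rfl fun j _ => ?_
    ring
  simp_rw [h1]
  rw [integral_fintype_prod_eq_prod (𝕜 := ℂ)
    (f := fun j (y : ℝ) => Complex.exp (((t * x j : ℝ) : ℂ) * (y : ℂ) * Complex.I))]
  simp_rw [← charFun_apply_real, charFun_gaussianReal]
  rw [← Complex.exp_sum]
  congr 1
  have h2 : ((‖x‖ : ℝ) : ℂ) ^ 2 = ∑ j, (x j : ℂ) ^ 2 := by
    have := EuclideanSpace.real_norm_sq_eq x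
    exact_mod_cast this
  push_cast
  simp only [mul_zero, zero_mul, zero_sub]
  rw [h2, Finset.mul_sum, Finset.sum_mul, Finset.sum_div, ← Finset.sum_neg_distrib]
  refine Finset.sum_congr rfl fun j _ => ?_
  ring

lemma aux_relu (v : NNReal) :
    ∫ z, max z 0 ∂(gaussianReal 0 v) = √v / √(2 * π) := by
  rcases eq_or_ne v 0 with rfl | hv
  · simp
  have hv' : (0 : ℝ) < v := by positivity
  rw [integral_gaussianReal_eq_integral_smul hv]
  have h1 : (fun z => gaussianPDFReal 0 v z • max z 0) =
      Set.indicator (Set.Ioi 0) (fun z : ℝ => (√(2 * π * v))⁻¹ *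
        (z * rexp (-(1 / (2 * v : ℝ)) * z ^ 2))) := by
    ext z
    by_cases hz : 0 < z
    · rw [Set.indicator_of_mem (by exact hz), max_eq_left hz.le, gaussianPDFReal, smul_eq_mul,
        mul_assoc, mul_comm z]
      congr 3
      ring
    · rw [Set.indicator_of_notMem (by exact hz), max_eq_right (not_lt.1 hz), smul_zero]
  have h2 : ∫ z in Set.Ioi (0 : ℝ), z * rexp (-(1 / (2 * v : ℝ)) * z ^ 2) = v := by
    have := integral_mul_cexp_neg_mul_sq (b := ((1 / (2 * v) : ℝ) : ℂ))
      (by rw [Complex.ofReal_re]; positivity)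
    have h3 : ∀ z : ℝ, (z : ℂ) * Complex.exp (-((1 / (2 * v) : ℝ) : ℂ) * (z : ℂ) ^ 2)
      = ((z * rexp (-(1 / (2 * v : ℝ)) * z ^ 2) : ℝ) : ℂ) := by intro z; push_cast; rfl
    simp_rw [h3] at this
    rw [integral_complex_ofReal] at this
    have h4 : ∫ z in Set.Ioi (0 : ℝ), z * rexp (-(1 / (2 * v : ℝ)) * z ^ 2)
      = (2 * (1 / (2 * v : ℝ)))⁻¹ := by exact_mod_cast this
    rw [h4]
    field_simp
  rw [h1, integral_indicator measurableSet_Ioi, integral_const_mul, h2,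
    Real.sqrt_mul (by positivity)]
  have h5 : √(v : ℝ) * √v = v := Real.mul_self_sqrt hv'.le
  have h6 : 0 < √(v : ℝ) := Real.sqrt_pos.2 hv'
  have h7 : 0 < √(2 * π) := by positivity
  field_simp
  nlinarith

theorem geometric_init_single_layer_expectation {d k : ℕ} (hk : 0 < k)
    (σ : ℝ) (hσ : 0 < σ) (r : ℝ) (hr : 0 < r) (x : EuclideanSpace ℝ (Fin d)) :
    ∫ W : Fin k → Fin d → ℝ,
        (Real.sqrt (2 * π) / (σ * k) * ∑ i, max (∑ j, W i j * x j) 0 - r)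
        ∂(Measure.pi fun _ : Fin k =>
            Measure.pi fun _ : Fin d => gaussianReal 0 ((σ ^ 2).toNNReal))
      = ‖x‖ - r := by
  set v := (σ ^ 2).toNNReal with hv
  have hmp : ∀ i : Fin k, MeasurePreserving (fun W : Fin k → Fin d → ℝ => ∑ j, W i j * x j)
      (Measure.pi fun _ : Fin k => Measure.pi fun _ : Fin d => gaussianReal 0 v)
      (gaussianReal 0 (v * ‖x‖₊ ^ 2)) := by
    intro i
    have a : MeasurePreserving (fun w : Fin d → ℝ => ∑ j, w j * x j)
      (Measure.pi fun _ : Fin d => gaussianReal 0 v) (gaussianReal 0 (v * ‖x‖₊ ^ 2)) :=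
      ⟨by fun_prop, aux_law v x⟩
    exact a.comp (measurePreserving_eval
      (fun _ : Fin k => Measure.pi fun _ : Fin d => gaussianReal 0 v) i)
  have hint0 : Integrable (fun z : ℝ => max z 0) (gaussianReal 0 (v * ‖x‖₊ ^ 2)) := by
    have : Integrable (id : ℝ → ℝ) (gaussianReal 0 (v * ‖x‖₊ ^ 2)) :=
      memLp_one_iff_integrable.1 (by exact_mod_cast memLp_id_gaussianReal 1)
    exact this.pos_part
  have hint : ∀ i : Fin k, Integrable (fun W : Fin k → Fin d → ℝ => max (∑ j, W i j * x j) 0)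
      (Measure.pi fun _ : Fin k => Measure.pi fun _ : Fin d => gaussianReal 0 v) :=
    fun i => (hmp i).integrable_comp_of_integrable hint0
  have hval : ∀ i : Fin k, ∫ W : Fin k → Fin d → ℝ, max (∑ j, W i j * x j) 0
      ∂(Measure.pi fun _ : Fin k => Measure.pi fun _ : Fin d => gaussianReal 0 v)
      = σ * ‖x‖ / √(2 * π) := by
    intro i
    have h := integral_map (μ := Measure.pi fun _ : Fin k =>
      Measure.pi fun _ : Fin d => gaussianReal 0 v) (hmp i).measurable.aemeasurable
      (f := fun z : ℝ => max z 0) (by fun_prop)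
    rw [← h, (hmp i).map_eq, aux_relu]
    congr 1
    have : ((v * ‖x‖₊ ^ 2 : NNReal) : ℝ) = (σ * ‖x‖) ^ 2 := by
      push_cast
      rw [hv, Real.coe_toNNReal _ (by positivity)]
      ring
    rw [this, Real.sqrt_sq (by positivity)]
  rw [integral_sub ((integrable_finsetSum _ fun i _ => hint i).const_mul _)
    (integrable_const _), integral_const_mul, integral_finsetSum _ fun i _ => hint i]
  simp_rw [hval]
  have h7 : 0 < √(2 * π) := by positivity
  have hk' : (0 : ℝ) < k := by exact_mod_cast hk
  simp
  field_simp
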